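/- Handler correspondence (Meaning Preservation at the level of result domains): let p : ℕ be a prompt name, valh : C → ResE D a value-clause denotation, and oph : α → (β → ResE D) → ResE D an operation-clause denotation, and define the deep Eff handler hE : ResE C → ResE D by structural recursion: hE (V v) = valh v; hE (E i v k) = oph v (fun b => hE (k b)) if i = p; and hE (E i v k) = E i v (fun b => hE (k b)) if i ≠ p. On the delimcc side, suppose valhD : C → Res D satisfies valhD x = ι (valh x) for all x, and ophD : α → (β → Res D) → Res D satisfies ophD v (fun b => ι (κ b)) = ι (oph v κ) for all v : α and κ : β → ResE D. Define h' : Free → Res D by structural recursion: h' (Ret x) = valhD x and h' (Act v kk) = ophD v (fun b => lift h' (kk b)), and define the translated handler hD : Res C → Res D by hD r = lift h' (pushpr p (lift (fun v => V (Ret v)) r)). Then hD (ι r) = ι (hE r) for every r : ResE C. -/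

import Mathlib

/-!
Fix types `α` (effect-operation argument type), `β` (effect-operation result
type, the continuation-value type `B`), and `C`.  `ResE` is the Core Eff
result domain; `Free` and the Core delimcc result domain `Res` (answer type
`W := Free`, `Ret : C → Free`) are defined by mutual (nested) induction.
Since the true body type `(β → Res Free) → Res Free` of a `shift0` is a
non-strictly-positive recursion, bodies are represented by an abstract type
`Bd` with application function `app`; the body `fun k' => V (Act v k')` used
by `ι` is represented by `act : α → Bd` with the hypothesis
`app (act v) = fun k' => V (Act v k')`.
-/

inductive Res (B Bd A : Type) : Type where
  | V : A → Res B Bd A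
  | E : ℕ → Bd → (B → Res B Bd A) → Res B Bd A

inductive Free (α β C Bd : Type) : Type where
  | Ret : C → Free α β C Bd
  | Act : α → (β → Res β Bd (Free α β C Bd)) → Free α β C Bd

def Res.lift {B Bd A C' : Type} (f : A → Res B Bd C') : Res B Bd A → Res B Bd C'
  | .V a => f a
  | .E q bd k => .E q bd (fun b => Res.lift f (k b))

def pushpr {B Bd W : Type} (app : Bd → (B → Res B Bd W) → Res B Bd W)
    (p : ℕ) : Res B Bd W → Res B Bd W
  | .V x => .V x
  | .E q bd k =>
      if q = p then app bd (fun c => pushpr app p (k c))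
      else .E q bd (fun c => pushpr app p (k c))

inductive ResE (α β A : Type) : Type where
  | V : A → ResE α β A
  | E : ℕ → α → (β → ResE α β A) → ResE α β A

/-- `ι (V a) = V a`, `ι (E i v k) = E i (act v) (fun b => ι (k b))`
(with `act v` representing the body `fun k' => V (Act v k')`). -/
def iota {α β Bd : Type} (act : α → Bd) {A : Type} : ResE α β A → Res β Bd A
  | .V a => .V a
  | .E i v k => .E i (act v) (fun b => iota act (k b))

/-- The deep Eff handler `hE` for prompt name `p`, value clause `valh` and
operation clause `oph`: `hE (V v) = valh v`;
`hE (E i v k) = oph v (fun b => hE (k b))` if `i = p`; and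
`hE (E i v k) = E i v (fun b => hE (k b))` if `i ≠ p`. -/
def hE {α β C D : Type} (p : ℕ)
    (valh : C → ResE α β D) (oph : α → (β → ResE α β D) → ResE α β D) :
    ResE α β C → ResE α β D
  | .V v => valh v
  | .E i v k =>
      if i = p then oph v (fun b => hE p valh oph (k b))
      else .E i v (fun b => hE p valh oph (k b))

/-- Handler correspondence (Meaning Preservation at the level of result
domains): suppose `valhD x = ι (valh x)` and
`ophD v (fun b => ι (κ b)) = ι (oph v κ)`, and let `h' : Free → Res D`
satisfy its defining recursive equations `h' (Ret x) = valhD x` and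
`h' (Act v kk) = ophD v (fun b => lift h' (kk b))`.  Then the translated
handler `hD r = lift h' (pushpr p (lift (fun v => V (Ret v)) r))` satisfies
`hD (ι r) = ι (hE r)` for every `r : ResE C`. -/
theorem handler_correspondence {α β C D Bd : Type}
    (act : α → Bd)
    (app : Bd → (β → Res β Bd (Free α β C Bd)) → Res β Bd (Free α β C Bd))
    (happ : ∀ (v : α) (k' : β → Res β Bd (Free α β C Bd)),
        app (act v) k' = Res.V (Free.Act v k'))
    (p : ℕ)
    (valh : C → ResE α β D) (oph : α → (β → ResE α β D) → ResE α β D)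
    (valhD : C → Res β Bd D) (ophD : α → (β → Res β Bd D) → Res β Bd D)
    (hvalhD : ∀ x, valhD x = iota act (valh x))
    (hophD : ∀ (v : α) (κ : β → ResE α β D),
        ophD v (fun b => iota act (κ b)) = iota act (oph v κ))
    (h' : Free α β C Bd → Res β Bd D)
    (hRet : ∀ x, h' (.Ret x) = valhD x)
    (hAct : ∀ (v : α) (kk : β → Res β Bd (Free α β C Bd)),
        h' (.Act v kk) = ophD v (fun b => Res.lift h' (kk b)))
    (r : ResE α β C) :
    Res.lift h' (pushpr app p (Res.lift (fun v => Res.V (Free.Ret v)) (iota act r)))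
      = iota act (hE p valh oph r) := by
  induction r with
  | V x => simp [iota, Res.lift, pushpr, hE, hRet, hvalhD]
  | E i v k ih =>
    by_cases h : i = p
    · simp only [iota, Res.lift, pushpr, hE, if_pos h, happ, hAct, ih, hophD]
    · simp only [iota, Res.lift, pushpr, hE, if_neg h, ih]
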